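/- arXiv:2504.06364 — 4 statements merged into one kernel-verified Lean document; each statement's English description precedes it below -/
import Mathlib

section
/- Let X be a measurable space, let N and ρ be finite measures on X, let 0 < c₁ ≤ c₂, and let λ*, λ̃ : X → ℝ be measurable functions with c₁ ≤ λ*(x) ≤ c₂ and c₁ ≤ λ̃(x) ≤ c₂ for all x ∈ X. Define the log-likelihood functional ℓ[λ] = ∫_X log λ(x) dN(x) − ∫_X λ(x) dρ(x) and set δλ = λ̃ − λ*. Then ℓ[λ*] − ℓ[λ̃] ≥ −( ∫_X (δλ(x)/λ*(x)) dN(x) − ∫_X δλ(x) dρ(x) ) + (1/(2 c₂²)) ∫_X (δλ(x))² dN(x). -/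
open MeasureTheory

lemma aux_hasDeriv (a c x : ℝ) (hx : x ≠ 0) :
    HasDerivAt (fun b : ℝ => Real.log b - (b - a) / a + (b - a) ^ 2 / (2 * c ^ 2))
      (x⁻¹ - 1 / a + (2 * (x - a)) / (2 * c ^ 2)) x := by
  have h1 := Real.hasDerivAt_log hx
  have h0 : HasDerivAt (fun b : ℝ => b - a) 1 x := (hasDerivAt_id x).sub_const a
  have h2 := h0.div_const a
  have h3 := (h0.pow 2).div_const (2 * c ^ 2)
  have h4 := (h1.sub h2).add h3
  refine h4.congr_deriv ?_
  norm_num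

lemma aux_deriv_eq (a c x : ℝ) (ha : 0 < a) (hx : 0 < x) (hc : 0 < c) :
    x⁻¹ - 1 / a + (2 * (x - a)) / (2 * c ^ 2)
      = (x - a) * (-((c ^ 2 - a * x) / (a * x * c ^ 2))) := by
  field_simp
  ring

lemma aux_pointwise (a b c : ℝ) (ha : 0 < a) (hb : 0 < b) (hac : a ≤ c) (hbc : b ≤ c) :
    Real.log b - (b - a) / a + (b - a) ^ 2 / (2 * c ^ 2) ≤ Real.log a := by
  have hc : 0 < c := ha.trans_le hac
  set f := fun b : ℝ => Real.log b - (b - a) / a + (b - a) ^ 2 / (2 * c ^ 2) with hf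
  have hfa : f a = Real.log a := by simp [hf]
  change f b ≤ Real.log a
  rw [← hfa]
  have hq : ∀ x, 0 < x → x ≤ c → 0 ≤ (c ^ 2 - a * x) / (a * x * c ^ 2) := by
    intro x hx hxc
    apply div_nonneg
    · nlinarith
    · positivity
  rcases le_total a b with h | h
  · have : AntitoneOn f (Set.Icc a b) := by
      apply antitoneOn_of_deriv_nonpos (convex_Icc a b)
      · intro x hx
        exact (aux_hasDeriv a c x (ha.trans_le hx.1).ne').continuousAt.continuousWithinAt
      · intro x hx
        rw [interior_Icc] at hx
        exact (aux_hasDeriv a c x (ha.trans hx.1).ne').differentiableAt.differentiableWithinAt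
      · intro x hx
        rw [interior_Icc] at hx
        have hx0 := ha.trans hx.1
        rw [(aux_hasDeriv a c x hx0.ne').deriv, aux_deriv_eq a c x ha hx0 hc]
        have := hq x hx0 (hx.2.le.trans hbc)
        exact mul_nonpos_of_nonneg_of_nonpos (by linarith [hx.1]) (by linarith)
    exact this (Set.left_mem_Icc.2 h) (Set.right_mem_Icc.2 h) h
  · have : MonotoneOn f (Set.Icc b a) := by
      apply monotoneOn_of_deriv_nonneg (convex_Icc b a)
      · intro x hx
        exact (aux_hasDeriv a c x (hb.trans_le hx.1).ne').continuousAt.continuousWithinAt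
      · intro x hx
        rw [interior_Icc] at hx
        exact (aux_hasDeriv a c x (hb.trans hx.1).ne').differentiableAt.differentiableWithinAt
      · intro x hx
        rw [interior_Icc] at hx
        have hx0 := hb.trans hx.1
        rw [(aux_hasDeriv a c x hx0.ne').deriv, aux_deriv_eq a c x ha hx0 hc]
        have := hq x hx0 (hx.2.le.trans hac)
        exact mul_nonneg_of_nonpos_of_nonpos (by linarith [hx.2]) (by linarith)
    exact this (Set.left_mem_Icc.2 h) (Set.right_mem_Icc.2 h) h

/-- Single-trajectory, pathwise form of the local perturbation of the
point-process log-likelihood around the true intensity (Lemma 1):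
for intensities `λ*`, `λ̃` with values in `[c₁, c₂]`, `0 < c₁ ≤ c₂`, setting
`ℓ[λ] = ∫ log λ dN − ∫ λ dρ` and `δλ = λ̃ − λ*`, one has
`ℓ[λ*] − ℓ[λ̃] ≥ −(∫ δλ/λ* dN − ∫ δλ dρ) + (1/(2c₂²)) ∫ δλ² dN`. -/
theorem loglik_perturbation_single_trajectory
    {X : Type*} [MeasurableSpace X]
    (N ρ : Measure X) [IsFiniteMeasure N] [IsFiniteMeasure ρ]
    (c₁ c₂ : ℝ) (hc₁ : 0 < c₁) (hc : c₁ ≤ c₂)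
    (lamStar lamTil : X → ℝ)
    (hmStar : Measurable lamStar) (hmTil : Measurable lamTil)
    (hbStar : ∀ x, c₁ ≤ lamStar x ∧ lamStar x ≤ c₂)
    (hbTil : ∀ x, c₁ ≤ lamTil x ∧ lamTil x ≤ c₂) :
    ((∫ x, Real.log (lamStar x) ∂N) - ∫ x, lamStar x ∂ρ)
      - ((∫ x, Real.log (lamTil x) ∂N) - ∫ x, lamTil x ∂ρ)
    ≥ -((∫ x, (lamTil x - lamStar x) / lamStar x ∂N)
          - ∫ x, (lamTil x - lamStar x) ∂ρ)
      + (1 / (2 * c₂ ^ 2)) * ∫ x, (lamTil x - lamStar x) ^ 2 ∂N := by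
  have pS : ∀ x, 0 < lamStar x := fun x => hc₁.trans_le (hbStar x).1
  have pT : ∀ x, 0 < lamTil x := fun x => hc₁.trans_le (hbTil x).1
  have iS : Integrable lamStar ρ :=
    Integrable.of_mem_Icc c₁ c₂ hmStar.aemeasurable (Filter.Eventually.of_forall hbStar)
  have iT : Integrable lamTil ρ :=
    Integrable.of_mem_Icc c₁ c₂ hmTil.aemeasurable (Filter.Eventually.of_forall hbTil)
  have iLS : Integrable (fun x => Real.log (lamStar x)) N :=
    Integrable.of_mem_Icc (Real.log c₁) (Real.log c₂) hmStar.log.aemeasurable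
      (Filter.Eventually.of_forall fun x =>
        ⟨Real.log_le_log hc₁ (hbStar x).1, Real.log_le_log (pS x) (hbStar x).2⟩)
  have iLT : Integrable (fun x => Real.log (lamTil x)) N :=
    Integrable.of_mem_Icc (Real.log c₁) (Real.log c₂) hmTil.log.aemeasurable
      (Filter.Eventually.of_forall fun x =>
        ⟨Real.log_le_log hc₁ (hbTil x).1, Real.log_le_log (pT x) (hbTil x).2⟩)
  have iD : Integrable (fun x => (lamTil x - lamStar x) / lamStar x) N := by
    refine Integrable.of_mem_Icc (-1) (c₂ / c₁)
      ((hmTil.sub hmStar).div hmStar).aemeasurable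
      (Filter.Eventually.of_forall fun x => ⟨?_, ?_⟩)
    · rw [le_div_iff₀ (pS x)]
      linarith [pT x]
    · exact div_le_div₀ (by linarith) (by linarith [pS x, (hbTil x).2]) hc₁ (hbStar x).1
  have iQ : Integrable (fun x => (lamTil x - lamStar x) ^ 2) N := by
    refine Integrable.of_mem_Icc 0 (c₂ ^ 2)
      ((hmTil.sub hmStar).pow_const 2).aemeasurable
      (Filter.Eventually.of_forall fun x => ⟨sq_nonneg _, ?_⟩)
    apply sq_le_sq'
    · linarith [pT x, (hbStar x).2]
    · linarith [pS x, (hbTil x).2]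
  have key : ∫ x, (Real.log (lamTil x) - (lamTil x - lamStar x) / lamStar x
        + (1 / (2 * c₂ ^ 2)) * (lamTil x - lamStar x) ^ 2) ∂N
      ≤ ∫ x, Real.log (lamStar x) ∂N := by
    apply integral_mono ((iLT.sub iD).add (iQ.const_mul _)) iLS
    intro x
    have := aux_pointwise _ _ c₂ (pS x) (pT x) (hbStar x).2 (hbTil x).2
    rw [div_eq_inv_mul _ (2 * c₂ ^ 2), ← one_div] at this
    exact this
  have iLD : Integrable (fun x => Real.log (lamTil x)
      - (lamTil x - lamStar x) / lamStar x) N := iLT.sub iD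
  rw [integral_add iLD (iQ.const_mul _), integral_sub iLT iD,
    integral_const_mul] at key
  rw [integral_sub iT iS]
  linarith
end

section
/- Let X be a measurable space equipped with a measurable time map t : X → ℝ and a finite measure ρ on X, and let 0 < c₁ ≤ c₂. For j = 1, …, M let E_j ⊂ X be a finite set of events and let N_j be the counting measure of E_j. For a bounded measurable kernel k : X × X → ℝ and a constant baseline μ₀ ≥ 0, define the induced intensity λ_j[k](x) = μ₀ + Σ_{x' ∈ E_j, t(x') < t(x)} k(x', x), and define the averaged log-likelihood ℓ[k] = (1/M) Σ_{j=1}^M ( ∫_X log λ_j[k](x) dN_j(x) − ∫_X λ_j[k](x) dρ(x) ). Suppose k* and k̃ are bounded measurable kernels such that c₁ ≤ λ_j[k*](x) ≤ c₂ and c₁ ≤ λ_j[k̃](x) ≤ c₂ for all x ∈ X and all j. Then, with δλ_j(x) = Σ_{x' ∈ E_j, t(x') < t(x)} (k̃(x', x) − k*(x', x)), it holds that ℓ[k*] − ℓ[k̃] ≥ (1/M) Σ_{j=1}^M [ −( ∫_X (δλ_j(x)/λ_j[k*](x)) dN_j(x) − ∫_X δλ_j(x) dρ(x) ) + (1/(2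 c₂²)) ∫_X (δλ_j(x))² dN_j(x) ]. -/
open MeasureTheory

/-- The counting measure of a finite set of events `E`. -/
noncomputable def countingMeasure {X : Type*} [MeasurableSpace X] (E : Finset X) :
    Measure X :=
  ∑ x ∈ E, Measure.dirac x

/-- The conditional intensity induced by a kernel `k`, a baseline `μ₀`, and a finite
set of events `E` in a space with time map `tm`:
`λ[k](x) = μ₀ + Σ_{x' ∈ E, tm x' < tm x} k(x', x)`. -/
noncomputable def inducedIntensity {X : Type*} (tm : X → ℝ) (E : Finset X)
    (μ₀ : ℝ) (k : X → X → ℝ) (x : X) : ℝ :=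
  μ₀ + ∑ x' ∈ E, if tm x' < tm x then k x' x else 0

lemma aux_integral {X : Type*} [MeasurableSpace X] (E : Finset X) (f : X → ℝ)
    (hf : Measurable f) : ∫ x, f x ∂(countingMeasure E) = ∑ x ∈ E, f x := by
  unfold countingMeasure
  rw [integral_finsetSum_measure]
  · exact Finset.sum_congr rfl fun x _ => integral_dirac' f x hf.stronglyMeasurable
  · intro x _
    exact (integrable_dirac' hf.stronglyMeasurable (by simp))

lemma aux_meas {X : Type*} [MeasurableSpace X] (tm : X → ℝ) (htm : Measurable tm)
    (E : Finset X) (k : X → X → ℝ) (hk : Measurable (Function.uncurry k)) :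
    Measurable (fun x => ∑ x' ∈ E, if tm x' < tm x then k x' x else 0) := by
  refine Finset.measurable_sum _ fun x' _ => ?_
  refine Measurable.ite (measurableSet_lt measurable_const htm) ?_ measurable_const
  exact hk.comp measurable_prodMk_left

lemma aux_log (a b c : ℝ) (ha : 0 < a) (hb : 0 < b) (hac : a ≤ c) (hbc : b ≤ c) :
    Real.log b ≤ Real.log a + (b - a) / a - 1 / (2 * c ^ 2) * (b - a) ^ 2 := by
  have hc : 0 < c := ha.trans_le hac
  let F : ℝ → ℝ := fun x => Real.log x - (x - a) / a + 1 / (2 * c ^ 2) * (x - a) ^ 2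
  have hd : ∀ x, 0 < x → HasDerivAt F ((x - a) * (1 / c ^ 2 - 1 / (a * x))) x := by
    intro x hx
    have h1 := Real.hasDerivAt_log hx.ne'
    have h2 := ((hasDerivAt_id x).sub_const a)
    have h3 := (h1.sub (h2.div_const a)).add ((h2.pow 2).const_mul (1 / (2 * c ^ 2)))
    refine h3.congr_deriv ?_
    simp
    field_simp
    ring
  have hle : ∀ x, 0 < x → x ≤ c → 1 / c ^ 2 - 1 / (a * x) ≤ 0 := by
    intro x hx hxc
    have : 1 / c ^ 2 ≤ 1 / (a * x) := by
      apply one_div_le_one_div_of_le (by positivity)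
      nlinarith
    linarith
  have key : F b ≤ F a := by
    rcases le_total a b with h | h
    · have : AntitoneOn F (Set.Icc a b) := by
        apply antitoneOn_of_deriv_nonpos (convex_Icc a b)
        · exact fun x hx => (hd x (ha.trans_le hx.1)).continuousAt.continuousWithinAt
        · intro x hx
          rw [interior_Icc] at hx
          exact (hd x (ha.trans hx.1)).differentiableAt.differentiableWithinAt
        · intro x hx
          rw [interior_Icc] at hx
          rw [(hd x (ha.trans hx.1)).deriv]
          exact mul_nonpos_of_nonneg_of_nonpos (by linarith [hx.1])
            (hle x (ha.trans hx.1) (by linarith [hx.2]))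
      exact this ⟨le_rfl, h⟩ ⟨h, le_rfl⟩ h
    · have : MonotoneOn F (Set.Icc b a) := by
        apply monotoneOn_of_deriv_nonneg (convex_Icc b a)
        · exact fun x hx => (hd x (hb.trans_le hx.1)).continuousAt.continuousWithinAt
        · intro x hx
          rw [interior_Icc] at hx
          exact (hd x (hb.trans hx.1)).differentiableAt.differentiableWithinAt
        · intro x hx
          rw [interior_Icc] at hx
          rw [(hd x (hb.trans hx.1)).deriv]
          exact mul_nonneg_of_nonpos_of_nonpos (by linarith [hx.2])
            (hle x (hb.trans hx.1) (by linarith [hx.2]))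
      exact this ⟨le_rfl, h⟩ ⟨h, le_rfl⟩ h
  simp only [F, sub_self] at key
  norm_num at key ⊢
  linarith

/-- Local perturbation of the averaged log-likelihood around the true kernel
(Lemma 1, pathwise over `M` trajectories): with
`ℓ[k] = (1/M) Σ_j (∫ log λ_j[k] dN_j − ∫ λ_j[k] dρ)` and
`δλ_j = λ_j[k̃] − λ_j[k*]`, if all induced intensities lie in `[c₁, c₂]`, then
`ℓ[k*] − ℓ[k̃] ≥ (1/M) Σ_j [ −(∫ δλ_j/λ_j[k*] dN_j − ∫ δλ_j dρ)
  + (1/(2c₂²)) ∫ δλ_j² dN_j ]`. -/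
theorem loglik_perturbation_multi_trajectory
    {X : Type*} [MeasurableSpace X]
    (tm : X → ℝ) (htm : Measurable tm)
    (ρ : Measure X) [IsFiniteMeasure ρ]
    (c₁ c₂ : ℝ) (hc₁ : 0 < c₁) (hc : c₁ ≤ c₂)
    (M : ℕ) (E : Fin M → Finset X)
    (μ₀ : ℝ) (hμ₀ : 0 ≤ μ₀)
    (kStar kTil : X → X → ℝ)
    (hkStarMeas : Measurable (Function.uncurry kStar))
    (hkTilMeas : Measurable (Function.uncurry kTil))
    (hkStarBdd : ∃ C : ℝ, ∀ x x' : X, |kStar x x'| ≤ C)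
    (hkTilBdd : ∃ C : ℝ, ∀ x x' : X, |kTil x x'| ≤ C)
    (hbStar : ∀ (j : Fin M) (x : X),
      c₁ ≤ inducedIntensity tm (E j) μ₀ kStar x ∧
        inducedIntensity tm (E j) μ₀ kStar x ≤ c₂)
    (hbTil : ∀ (j : Fin M) (x : X),
      c₁ ≤ inducedIntensity tm (E j) μ₀ kTil x ∧
        inducedIntensity tm (E j) μ₀ kTil x ≤ c₂) :
    (1 / (M : ℝ)) * ∑ j : Fin M,
        ((∫ x, Real.log (inducedIntensity tm (E j) μ₀ kStar x) ∂(countingMeasure (E j)))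
          - ∫ x, inducedIntensity tm (E j) μ₀ kStar x ∂ρ)
      - (1 / (M : ℝ)) * ∑ j : Fin M,
        ((∫ x, Real.log (inducedIntensity tm (E j) μ₀ kTil x) ∂(countingMeasure (E j)))
          - ∫ x, inducedIntensity tm (E j) μ₀ kTil x ∂ρ)
    ≥ (1 / (M : ℝ)) * ∑ j : Fin M,
        (-((∫ x, (∑ x' ∈ E j, if tm x' < tm x then kTil x' x - kStar x' x else 0)
                / inducedIntensity tm (E j) μ₀ kStar x ∂(countingMeasure (E j)))
            - ∫ x, (∑ x' ∈ E j, if tm x' < tm x then kTil x' x - kStar x' x else 0) ∂ρ)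
          + (1 / (2 * c₂ ^ 2)) *
            ∫ x, (∑ x' ∈ E j, if tm x' < tm x then kTil x' x - kStar x' x else 0) ^ 2
              ∂(countingMeasure (E j))) := by
  have hδ : ∀ (j : Fin M) (x : X),
      (∑ x' ∈ E j, if tm x' < tm x then kTil x' x - kStar x' x else 0)
        = inducedIntensity tm (E j) μ₀ kTil x - inducedIntensity tm (E j) μ₀ kStar x := by
    intro j x
    unfold inducedIntensity
    rw [add_sub_add_left_eq_sub, ← Finset.sum_sub_distrib]
    refine Finset.sum_congr rfl fun x' _ => ?_
    split_ifs <;> simp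
  simp only [hδ]
  rw [ge_iff_le, ← mul_sub, ← Finset.sum_sub_distrib]
  refine mul_le_mul_of_nonneg_left (Finset.sum_le_sum fun j _ => ?_) (by positivity)
  have mS : Measurable (inducedIntensity tm (E j) μ₀ kStar) :=
    measurable_const.add (aux_meas tm htm (E j) kStar hkStarMeas)
  have mT : Measurable (inducedIntensity tm (E j) μ₀ kTil) :=
    measurable_const.add (aux_meas tm htm (E j) kTil hkTilMeas)
  have iS : Integrable (inducedIntensity tm (E j) μ₀ kStar) ρ :=
    Integrable.of_bound mS.aestronglyMeasurable c₂ (Filter.Eventually.of_forall fun x => by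
      rw [Real.norm_eq_abs, abs_of_pos (hc₁.trans_le (hbStar j x).1)]; exact (hbStar j x).2)
  have iT : Integrable (inducedIntensity tm (E j) μ₀ kTil) ρ :=
    Integrable.of_bound mT.aestronglyMeasurable c₂ (Filter.Eventually.of_forall fun x => by
      rw [Real.norm_eq_abs, abs_of_pos (hc₁.trans_le (hbTil j x).1)]; exact (hbTil j x).2)
  rw [aux_integral _ _ mS.log, aux_integral _ _ mT.log,
    aux_integral _ (fun x => (inducedIntensity tm (E j) μ₀ kTil x - inducedIntensity tm (E j) μ₀ kStar x) / inducedIntensity tm (E j) μ₀ kStar x)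
      ((mT.sub mS).div mS),
    aux_integral _ (fun x => (inducedIntensity tm (E j) μ₀ kTil x - inducedIntensity tm (E j) μ₀ kStar x) ^ 2)
      ((mT.sub mS).pow_const 2),
    integral_sub iT iS]
  have key := Finset.sum_le_sum (s := E j) fun x _ =>
    aux_log (inducedIntensity tm (E j) μ₀ kStar x) (inducedIntensity tm (E j) μ₀ kTil x) c₂
      (hc₁.trans_le (hbStar j x).1) (hc₁.trans_le (hbTil j x).1) (hbStar j x).2 (hbTil j x).2
  rw [Finset.sum_sub_distrib, Finset.sum_add_distrib, ← Finset.mul_sum] at key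
  linarith
end

section
/- Let X be a measurable space, ρ a finite measure on X, and 0 < c₁ ≤ c₂. Let λ*, λ : X → ℝ be measurable with c₁ ≤ λ*(x) ≤ c₂ and c₁ ≤ λ(x) ≤ c₂ for all x ∈ X, and define L[λ] = ∫_X ( λ*(x) · log λ(x) − λ(x) ) dρ(x). If L[λ] = L[λ*], then λ = λ* holds ρ-almost everywhere. -/
open MeasureTheory

/-- Uniqueness part of identifiability of the true intensity by maximum likelihood:
if the expected log-likelihood `L[λ] = ∫ (λ* log λ − λ) dρ` achieves its maximal
value `L[λ*]`, then `λ = λ*` holds `ρ`-almost everywhere. -/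
theorem expected_loglik_maximizer_unique
    {X : Type*} [MeasurableSpace X]
    (ρ : Measure X) [IsFiniteMeasure ρ]
    (c₁ c₂ : ℝ) (hc₁ : 0 < c₁) (hc : c₁ ≤ c₂)
    (lamStar lam : X → ℝ)
    (hmStar : Measurable lamStar) (hm : Measurable lam)
    (hbStar : ∀ x, c₁ ≤ lamStar x ∧ lamStar x ≤ c₂)
    (hb : ∀ x, c₁ ≤ lam x ∧ lam x ≤ c₂)
    (heq : (∫ x, (lamStar x * Real.log (lam x) - lam x) ∂ρ)
        = ∫ x, (lamStar x * Real.log (lamStar x) - lamStar x) ∂ρ) :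
    lam =ᵐ[ρ] lamStar := by
  have hint : ∀ f : X → ℝ, Measurable f → (∀ x, c₁ ≤ f x ∧ f x ≤ c₂) →
      Integrable (fun x => lamStar x * Real.log (f x) - f x) ρ := by
    intro f hf hfb
    have hM : Measurable (fun x => lamStar x * Real.log (f x) - f x) :=
      (hmStar.mul (Real.measurable_log.comp hf)).sub hf
    refine Integrable.of_bound hM.aestronglyMeasurable
      (c₂ * (|Real.log c₁| + |Real.log c₂|) + c₂) (Filter.Eventually.of_forall fun x => ?_)
    obtain ⟨h1, h2⟩ := hfb x
    obtain ⟨h3, h4⟩ := hbStar x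
    have hfx : 0 < f x := hc₁.trans_le h1
    have l1 := Real.log_le_log hc₁ h1
    have l2 := Real.log_le_log hfx h2
    have hl : |Real.log (f x)| ≤ |Real.log c₁| + |Real.log c₂| := by
      rw [abs_le]
      constructor
      · linarith [neg_abs_le (Real.log c₁), abs_nonneg (Real.log c₂)]
      · linarith [le_abs_self (Real.log c₂), abs_nonneg (Real.log c₁)]
    rw [Real.norm_eq_abs]
    refine (abs_sub _ _).trans ?_
    rw [abs_mul, abs_of_pos hfx, abs_of_pos (hc₁.trans_le h3)]
    have := mul_le_mul h4 hl (abs_nonneg _) (by linarith)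
    linarith
  have h1 := hint lam hm hb
  have h2 := hint lamStar hmStar hbStar
  have key : ∀ a b : ℝ, 0 < a → 0 < b → b ≠ a →
      0 < (a * Real.log a - a) - (a * Real.log b - b) := by
    intro a b ha hb' hne
    have h := Real.log_lt_sub_one_of_pos (div_pos hb' ha)
      (fun h => hne ((div_eq_one_iff_eq ha.ne').1 h))
    rw [Real.log_div hb'.ne' ha.ne'] at h
    have h' := mul_lt_mul_of_pos_left h ha
    have e : a * (b / a - 1) = b - a := by field_simp
    rw [e] at h'
    nlinarith
  have hpos : ∀ x, 0 < lam x := fun x => hc₁.trans_le (hb x).1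
  have hposS : ∀ x, 0 < lamStar x := fun x => hc₁.trans_le (hbStar x).1
  have h0 : ∫ x, ((lamStar x * Real.log (lamStar x) - lamStar x)
      - (lamStar x * Real.log (lam x) - lam x)) ∂ρ = 0 := by
    rw [integral_sub h2 h1, heq, sub_self]
  have hnn : 0 ≤ fun x => (lamStar x * Real.log (lamStar x) - lamStar x)
      - (lamStar x * Real.log (lam x) - lam x) := by
    intro x
    by_cases hne : lam x = lamStar x
    · simp [hne]
    · exact (key _ _ (hposS x) (hpos x) hne).le
  have h3 := (integral_eq_zero_iff_of_nonneg hnn (h2.sub h1)).1 h0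
  filter_upwards [h3] with x hx
  by_contra hne
  exact (key _ _ (hposS x) (hpos x) hne).ne' hx
end

section
/- Let X be a measurable space equipped with a measurable time map t : X → ℝ and a finite measure ρ on X, and let 0 < c₁ ≤ c₂. For j = 1, …, M let E_j ⊂ X be a finite set of events. For a bounded measurable kernel k : X × X → ℝ and a constant baseline μ₀ ≥ 0, define λ_j[k](x) = μ₀ + Σ_{x' ∈ E_j, t(x') < t(x)} k(x', x). Let k* and k be bounded measurable kernels with c₁ ≤ λ_j[k*](x) ≤ c₂ and c₁ ≤ λ_j[k](x) ≤ c₂ for all x ∈ X and all j, and define the averaged expected log-likelihood L̄[k] = (1/M) Σ_{j=1}^M ∫_X ( λ_j[k*](x) · log λ_j[k](x) − λ_j[k](x) ) dρ(x). Then L̄[k*] − L̄[k] ≥ (c₁/(2 c₂² M)) Σ_{j=1}^M ∫_X ( λ_j[k](x) − λ_j[k*](x) )² dρ(x) ≥ 0; in particular, k* maximizes L̄ over all kernels in the class satisfying the intensity bounds. -/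
open MeasureTheory

theorem kid_pointwise (c₁ c₂ a b : ℝ) (hc₁ : 0 < c₁) (ha : c₁ ≤ a) (ha2 : a ≤ c₂)
    (hb : c₁ ≤ b) (hb2 : b ≤ c₂) :
    c₁ / (2 * c₂ ^ 2) * (b - a) ^ 2 ≤ (a * Real.log a - a) - (a * Real.log b - b) := by
  have hc₂ : 0 < c₂ := by linarith
  set h : ℝ → ℝ := fun y => y - a * Real.log y - c₁ / (2 * c₂ ^ 2) * (y - a) ^ 2 with hh
  have hd : ∀ y : ℝ, 0 < y → HasDerivAt h ((y - a) * (1 / y - c₁ / c₂ ^ 2)) y := by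
    intro y hy
    have h1 := ((hasDerivAt_id y).sub ((Real.hasDerivAt_log hy.ne').const_mul a)).sub
      ((((hasDerivAt_id y).sub_const a).pow 2).const_mul (c₁ / (2 * c₂ ^ 2)))
    refine h1.congr_deriv ?_
    simp
    field_simp
  have hpos : ∀ y : ℝ, 0 < y → y ≤ c₂ → 0 ≤ 1 / y - c₁ / c₂ ^ 2 := by
    intro y hy hy2
    rw [sub_nonneg, div_le_div_iff₀ (by positivity) hy]
    nlinarith
  have key : h a ≤ h b := by
    rcases le_total a b with hab | hab
    · have hm : MonotoneOn h (Set.Icc a b) := by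
        apply monotoneOn_of_deriv_nonneg (convex_Icc a b)
        · intro y hy
          exact (hd y (by linarith [hy.1])).continuousAt.continuousWithinAt
        · intro y hy
          rw [interior_Icc] at hy
          exact (hd y (by linarith [hy.1])).differentiableAt.differentiableWithinAt
        · intro y hy
          rw [interior_Icc] at hy
          rw [(hd y (by linarith [hy.1])).deriv]
          exact mul_nonneg (by linarith [hy.1]) (hpos y (by linarith [hy.1]) (by linarith [hy.2]))
      exact hm ⟨le_refl _, hab⟩ ⟨hab, le_refl _⟩ hab
    · have hm : AntitoneOn h (Set.Icc b a) := by
        apply antitoneOn_of_deriv_nonpos (convex_Icc b a)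
        · intro y hy
          exact (hd y (by linarith [hy.1])).continuousAt.continuousWithinAt
        · intro y hy
          rw [interior_Icc] at hy
          exact (hd y (by linarith [hy.1])).differentiableAt.differentiableWithinAt
        · intro y hy
          rw [interior_Icc] at hy
          rw [(hd y (by linarith [hy.1])).deriv]
          exact mul_nonpos_of_nonpos_of_nonneg (by linarith [hy.2])
            (hpos y (by linarith [hy.1]) (by linarith [hy.2]))
      exact hm ⟨le_refl _, hab⟩ ⟨hab, le_refl _⟩ hab
  simp only [hh, sub_self] at key
  linarith

theorem kid_measurable {X : Type*} [MeasurableSpace X]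
    (tm : X → ℝ) (htm : Measurable tm) (E : Finset X) (μ₀ : ℝ) (k : X → X → ℝ)
    (hk : Measurable (Function.uncurry k)) : Measurable (inducedIntensity tm E μ₀ k) := by
  unfold inducedIntensity
  refine measurable_const.add (Finset.measurable_fun_sum _ fun x' _ => ?_)
  refine Measurable.ite (measurableSet_lt measurable_const htm) ?_ measurable_const
  exact hk.comp measurable_prodMk_left

theorem kid_integrable {X : Type*} [MeasurableSpace X] (ρ : Measure X) [IsFiniteMeasure ρ]
    (c₁ c₂ : ℝ) (hc₁ : 0 < c₁) (f g : X → ℝ) (hf : Measurable f) (hg : Measurable g)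
    (hfb : ∀ x, c₁ ≤ f x ∧ f x ≤ c₂) (hgb : ∀ x, c₁ ≤ g x ∧ g x ≤ c₂) :
    Integrable (fun x => f x * Real.log (g x) - g x) ρ := by
  have hbd : ∀ u : X → ℝ, Measurable u → ∀ p q : ℝ, (∀ x, p ≤ u x ∧ u x ≤ q) →
      Integrable u ρ := fun u hu p q h =>
    Integrable.of_mem_Icc p q hu.aemeasurable (Filter.Eventually.of_forall h)
  refine Integrable.sub ?_ (hbd g hg _ _ hgb)
  refine (hbd _ (Real.measurable_log.comp hg) (Real.log c₁) (Real.log c₂) fun x =>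
    ⟨Real.log_le_log hc₁ (hgb x).1,
      Real.log_le_log (by linarith [(hgb x).1]) (hgb x).2⟩).bdd_mul (c := c₂)
    hf.aestronglyMeasurable (Filter.Eventually.of_forall fun x => ?_)
  rw [Real.norm_eq_abs, abs_of_nonneg (by linarith [(hfb x).1])]
  exact (hfb x).2

/-- Kernel-level form of kernel identifiability (Theorem 1): for the averaged
expected log-likelihood `L̄[k] = (1/M) Σ_j ∫ (λ_j[k*] log λ_j[k] − λ_j[k]) dρ`,
if all induced intensities lie in `[c₁, c₂]` with `0 < c₁ ≤ c₂`, then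
`L̄[k*] − L̄[k] ≥ (c₁/(2c₂²M)) Σ_j ∫ (λ_j[k] − λ_j[k*])² dρ ≥ 0`;
in particular `k*` maximizes `L̄` over the kernel class. -/
theorem kernel_identifiability_expected_loglik
    {X : Type*} [MeasurableSpace X]
    (tm : X → ℝ) (htm : Measurable tm)
    (ρ : Measure X) [IsFiniteMeasure ρ]
    (c₁ c₂ : ℝ) (hc₁ : 0 < c₁) (hc : c₁ ≤ c₂)
    (M : ℕ) (E : Fin M → Finset X)
    (μ₀ : ℝ) (hμ₀ : 0 ≤ μ₀)
    (kStar k : X → X → ℝ)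
    (hkStarMeas : Measurable (Function.uncurry kStar))
    (hkMeas : Measurable (Function.uncurry k))
    (hkStarBdd : ∃ C : ℝ, ∀ x x' : X, |kStar x x'| ≤ C)
    (hkBdd : ∃ C : ℝ, ∀ x x' : X, |k x x'| ≤ C)
    (hbStar : ∀ (j : Fin M) (x : X),
      c₁ ≤ inducedIntensity tm (E j) μ₀ kStar x ∧
        inducedIntensity tm (E j) μ₀ kStar x ≤ c₂)
    (hb : ∀ (j : Fin M) (x : X),
      c₁ ≤ inducedIntensity tm (E j) μ₀ k x ∧
        inducedIntensity tm (E j) μ₀ k x ≤ c₂) :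
    ((1 / (M : ℝ)) * ∑ j : Fin M,
        (∫ x, (inducedIntensity tm (E j) μ₀ kStar x
              * Real.log (inducedIntensity tm (E j) μ₀ kStar x)
            - inducedIntensity tm (E j) μ₀ kStar x) ∂ρ)
      - (1 / (M : ℝ)) * ∑ j : Fin M,
        (∫ x, (inducedIntensity tm (E j) μ₀ kStar x
              * Real.log (inducedIntensity tm (E j) μ₀ k x)
            - inducedIntensity tm (E j) μ₀ k x) ∂ρ)
      ≥ (c₁ / (2 * c₂ ^ 2 * M)) * ∑ j : Fin M,
          ∫ x, (inducedIntensity tm (E j) μ₀ k x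
              - inducedIntensity tm (E j) μ₀ kStar x) ^ 2 ∂ρ)
    ∧ (c₁ / (2 * c₂ ^ 2 * M)) * (∑ j : Fin M,
          ∫ x, (inducedIntensity tm (E j) μ₀ k x
              - inducedIntensity tm (E j) μ₀ kStar x) ^ 2 ∂ρ) ≥ 0
    ∧ (1 / (M : ℝ)) * ∑ j : Fin M,
        (∫ x, (inducedIntensity tm (E j) μ₀ kStar x
              * Real.log (inducedIntensity tm (E j) μ₀ k x)
            - inducedIntensity tm (E j) μ₀ k x) ∂ρ)
      ≤ (1 / (M : ℝ)) * ∑ j : Fin M,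
        (∫ x, (inducedIntensity tm (E j) μ₀ kStar x
              * Real.log (inducedIntensity tm (E j) μ₀ kStar x)
            - inducedIntensity tm (E j) μ₀ kStar x) ∂ρ) := by
  have hj : ∀ j : Fin M, c₁ / (2 * c₂ ^ 2) * (∫ x, (inducedIntensity tm (E j) μ₀ k x
              - inducedIntensity tm (E j) μ₀ kStar x) ^ 2 ∂ρ) ≤
        (∫ x, (inducedIntensity tm (E j) μ₀ kStar x
              * Real.log (inducedIntensity tm (E j) μ₀ kStar x)
            - inducedIntensity tm (E j) μ₀ kStar x) ∂ρ) -
        (∫ x, (inducedIntensity tm (E j) μ₀ kStar x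
              * Real.log (inducedIntensity tm (E j) μ₀ k x)
            - inducedIntensity tm (E j) μ₀ k x) ∂ρ) := by
    intro j
    have m1 := kid_measurable tm htm (E j) μ₀ kStar hkStarMeas
    have m2 := kid_measurable tm htm (E j) μ₀ k hkMeas
    have i1 := kid_integrable ρ c₁ c₂ hc₁ _ _ m1 m1 (hbStar j) (hbStar j)
    have i2 := kid_integrable ρ c₁ c₂ hc₁ _ _ m1 m2 (hbStar j) (hb j)
    rw [← integral_sub i1 i2, ← integral_const_mul]
    refine integral_mono_of_nonneg (Filter.Eventually.of_forall fun x => by positivity)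
      (i1.sub i2) (Filter.Eventually.of_forall fun x => ?_)
    exact kid_pointwise c₁ c₂ _ _ hc₁ (hbStar j x).1 (hbStar j x).2 (hb j x).1 (hb j x).2
  have hsum := Finset.sum_le_sum fun j (_ : j ∈ Finset.univ) => hj j
  rw [← Finset.mul_sum, Finset.sum_sub_distrib] at hsum
  have h1 := mul_le_mul_of_nonneg_left hsum (by positivity : (0:ℝ) ≤ 1 / (M : ℝ))
  rw [← mul_assoc, mul_sub,
    show 1 / (M : ℝ) * (c₁ / (2 * c₂ ^ 2)) = c₁ / (2 * c₂ ^ 2 * M) by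
      rw [div_mul_div_comm, one_mul, mul_comm (M : ℝ)]] at h1
  have h2 : 0 ≤ (c₁ / (2 * c₂ ^ 2 * M)) * (∑ j : Fin M,
          ∫ x, (inducedIntensity tm (E j) μ₀ k x
              - inducedIntensity tm (E j) μ₀ kStar x) ^ 2 ∂ρ) :=
    mul_nonneg (by positivity) (Finset.sum_nonneg fun j _ =>
      integral_nonneg fun x => sq_nonneg _)
  exact ⟨h1, h2, by linarith⟩
end
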